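/- In the coin system, for every n ≥ 2, every reachable state (a, b, d₁, d₂) with a + b = n satisfies {a, b} = {⌊n/2⌋, ⌈n/2⌉}. (This combines Lemma 1 and Theorem 1 of the paper: when the two segment tails of the Fault Checking sub-algorithm meet on a line of n particles, the two segments are a floor/ceiling bisection of the line.) -/

import Mathlib

/-- A state of the coin system: left segment size `a`, right segment size `b`,
direction `d₁` of coin 1, direction `d₂` of coin 2
(`true` = travelling toward the right segment's tail). -/
abbrev CoinState := ℕ × ℕ × Bool × Bool

/-- One step of the coin system: deliver one of the two coins.
If its direction is `true` the right segment grows and the coin bounces;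
if `false` the left segment grows and the coin bounces. -/
inductive CoinStep : CoinState → CoinState → Prop
  | coin1_true  (a b : ℕ) (d₂ : Bool) : CoinStep (a, b, true, d₂) (a, b + 1, false, d₂)
  | coin1_false (a b : ℕ) (d₂ : Bool) : CoinStep (a, b, false, d₂) (a + 1, b, true, d₂)
  | coin2_true  (a b : ℕ) (d₁ : Bool) : CoinStep (a, b, d₁, true) (a, b + 1, d₁, false)
  | coin2_false (a b : ℕ) (d₁ : Bool) : CoinStep (a, b, d₁, false) (a + 1, b, d₁, true)

/-- A state is reachable if it is related to the initial state `(1, 1, true, false)`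
by the reflexive-transitive closure of the step relation. -/
def CoinReachable (s : CoinState) : Prop :=
  Relation.ReflTransGen CoinStep (1, 1, true, false) s

/-- Along any execution, the difference of the segment sizes is the number of coins travelling
toward the right segment's tail, minus one. -/
theorem CoinReachable.size_add_one_eq {s : CoinState} (h : CoinReachable s) :
    s.1 + 1 = s.2.1 + s.2.2.1.toNat + s.2.2.2.toNat := by
  induction h with
  | refl => rfl
  | tail _ hstep ih => cases hstep <;> simp at ih ⊢ <;> omega

/-- Lemma 1 + Theorem 1: when the two segment tails meet on a line of `n ≥ 2`
particles (i.e. `a + b = n`), the two segments are a floor/ceiling bisection of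
the line: `{a, b} = {⌊n/2⌋, ⌈n/2⌉}`. -/
theorem coin_bisection
    (n : ℕ) (hn : 2 ≤ n)
    (a b : ℕ) (d₁ d₂ : Bool) (h : CoinReachable (a, b, d₁, d₂))
    (hab : a + b = n) :
    ({a, b} : Set ℕ) = {n / 2, (n + 1) / 2} := by
  have hinv : a + 1 = b + d₁.toNat + d₂.toNat := h.size_add_one_eq
  have h₁ := d₁.toNat_le
  have h₂ := d₂.toNat_le
  rw [Set.pair_eq_pair_iff]
  omega
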